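/- Let E ⊆ ℤ^n satisfy E + ℕ^n = E (an ℕ^n-submodule of ℤ^n). Define its integral closure Ē = {α ∈ ℤ^n : ∃ r > 0, r·α ∈ rE}, where rE is the r-fold Minkowski sum of E, and its Newton polyhedron New(E) = conv(E) ⊆ ℝ^n. Then Ē = New(E) ∩ ℤ^n. -/

import Mathlib

open scoped Pointwise

/-- The `r`-fold Minkowski sum `E + ⋯ + E` (`r` summands; the empty sum is `{0}`). -/
def rFold {α : Type*} [AddCommMonoid α] : ℕ → Set α → Set α
  | 0, _ => {0}
  | k + 1, I => I + rFold k I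

/-- The inclusion `ℤ^n ⊆ ℝ^n`. -/
def intToReal (n : ℕ) (a : Fin n → ℤ) : Fin n → ℝ := fun i => (a i : ℝ)

/-- `ℕ^n` as a subset of `ℤ^n`. -/
def nonnegOrthant (n : ℕ) : Set (Fin n → ℤ) := {v | ∀ i, 0 ≤ v i}

theorem add_mem_rFold_add {α : Type*} [AddCommMonoid α] {E : Set α} {r s : ℕ} {x y : α}
    (hx : x ∈ rFold r E) (hy : y ∈ rFold s E) : x + y ∈ rFold (r + s) E := by
  induction r generalizing x with
  | zero =>
    obtain rfl : x = 0 := hx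
    simpa using hy
  | succ r ih =>
    obtain ⟨a, ha, b, hb, rfl⟩ := hx
    rw [Nat.add_right_comm]
    simp only [add_assoc a]
    exact Set.add_mem_add ha (ih hb)

theorem nsmul_mem_rFold {α : Type*} [AddCommMonoid α] {E : Set α} {x : α} (hx : x ∈ E) (r : ℕ) :
    r • x ∈ rFold r E := by
  induction r with
  | zero => exact zero_nsmul x
  | succ r ih =>
    rw [succ_nsmul']
    exact Set.add_mem_add hx ih

theorem sum_nsmul_mem_rFold {α ι : Type*} [AddCommMonoid α] {E : Set α} (t : Finset ι)
    (k : ι → ℕ) {p : ι → α} (hp : ∀ i, p i ∈ E) :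
    ∑ i ∈ t, k i • p i ∈ rFold (∑ i ∈ t, k i) E := by
  classical
  induction t using Finset.induction_on with
  | empty => exact Finset.sum_empty
  | insert a t ha ih =>
    rw [Finset.sum_insert ha, Finset.sum_insert ha]
    exact add_mem_rFold_add (nsmul_mem_rFold (hp a) _) ih

theorem intToReal_mem_smul_convexHull {n : ℕ} {E : Set (Fin n → ℤ)} (r : ℕ) {x : Fin n → ℤ}
    (hx : x ∈ rFold (r + 1) E) :
    intToReal n x ∈ ((r + 1 : ℕ) : ℝ) • convexHull ℝ (intToReal n '' E) := by
  induction r generalizing x with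
  | zero =>
    obtain ⟨a, ha, b, rfl, rfl⟩ := hx
    simpa using subset_convexHull ℝ _ (Set.mem_image_of_mem (intToReal n) ha)
  | succ r ih =>
    obtain ⟨a, ha, b, hb, rfl⟩ := hx
    have hab : intToReal n (a + b) = intToReal n b + intToReal n a := by
      ext i
      simp [intToReal, add_comm]
    rw [Nat.cast_succ, (convex_convexHull ℝ _).add_smul (Nat.cast_nonneg _) zero_le_one, one_smul]
    simp only [hab]
    exact Set.add_mem_add (ih hb) (subset_convexHull ℝ _ (Set.mem_image_of_mem _ ha))

/-- The barycentric coordinates of a lattice point with respect to affinely independent lattice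
points are rational. -/
theorem exists_rat_weights {n : ℕ} {ι : Type*} [Fintype ι] {p : ι → Fin n → ℤ}
    (hp : AffineIndependent ℝ fun i => intToReal n (p i)) {w : ι → ℝ} {x : Fin n → ℤ}
    (hw : ∑ i, w i = 1) (hx : ∑ i, w i • intToReal n (p i) = intToReal n x) :
    ∃ q : ι → ℚ, ∀ i, (q i : ℝ) = w i := by
  obtain ⟨φ, hφ⟩ := (Algebra.linearMap ℚ ℝ).exists_leftInverse_of_injective
    (LinearMap.ker_eq_bot.2 (algebraMap ℚ ℝ).injective)
  have hφq (q : ℚ) : φ (q : ℝ) = q := LinearMap.congr_fun hφ q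
  have hsum : ∑ i, φ (w i) = 1 := by
    rw [← map_sum, hw]
    simpa using hφq 1
  have hcoord (j : Fin n) : ∑ i, φ (w i) * (p i j : ℚ) = x j := by
    have h := congrArg φ (congrFun hx j)
    have hmul (i : ι) : φ (w i * (p i j : ℝ)) = φ (w i) * (p i j : ℚ) := by
      rw [mul_comm, ← zsmul_eq_mul, map_zsmul, zsmul_eq_mul, mul_comm]
    have hxj := hφq (x j)
    rw [Rat.cast_intCast] at hxj
    simpa [intToReal, hmul, hxj] using h
  refine ⟨fun i => φ (w i), fun i => ?_⟩
  have h := affineIndependent_iff.1 hp Finset.univ (fun i => (φ (w i) : ℝ) - w i) ?_ ?_ i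
    (Finset.mem_univ i)
  · exact sub_eq_zero.1 h
  · rw [Finset.sum_sub_distrib, hw, sub_eq_zero]
    exact_mod_cast hsum
  · simp only [sub_smul, Finset.sum_sub_distrib, hx, sub_eq_zero]
    ext j
    simpa [intToReal] using mod_cast congrArg (Rat.cast : ℚ → ℝ) (hcoord j)

theorem exists_common_denominator {ι : Type*} [Fintype ι] {q : ι → ℚ} (hq : ∀ i, 0 ≤ q i) :
    ∃ r : ℕ, 0 < r ∧ ∃ k : ι → ℕ, ∀ i, (k i : ℚ) = r * q i := by
  refine ⟨∏ i, (q i).den, Finset.prod_pos fun i _ => (q i).pos, ?_⟩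
  suffices h : ∀ i, ∃ k : ℕ, (k : ℚ) = (∏ i, (q i).den : ℕ) * q i from
    ⟨fun i => (h i).choose, fun i => (h i).choose_spec⟩
  intro i
  obtain ⟨c, hc⟩ := Finset.dvd_prod_of_mem (fun i => (q i).den) (Finset.mem_univ i)
  refine ⟨c * (q i).num.toNat, ?_⟩
  have hnum : (((q i).num.toNat : ℤ) : ℚ) = (q i).num := by
    rw [Int.toNat_of_nonneg (Rat.num_nonneg.2 (hq i))]
  rw [hc]
  push_cast at hnum ⊢
  rw [hnum, mul_comm, mul_right_comm, Rat.den_mul_eq_num]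

/-- If `E ⊆ ℤ^n` is an `ℕ^n`-submodule of `ℤ^n` (i.e. `E + ℕ^n = E`), then its integral
closure `Ē = {α ∈ ℤ^n : ∃ r > 0, r·α ∈ rE}` equals `New(E) ∩ ℤ^n = conv(E) ∩ ℤ^n`. -/
theorem stmt3 (n : ℕ) (E : Set (Fin n → ℤ))
    (hE : E + nonnegOrthant n = E) :
    {α : Fin n → ℤ | ∃ r : ℕ, 0 < r ∧ r • α ∈ rFold r E} =
    {α : Fin n → ℤ | intToReal n α ∈ convexHull ℝ (intToReal n '' E)} := by
  ext α
  constructor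
  · rintro ⟨r, hr, hα⟩
    obtain ⟨r, rfl⟩ := Nat.exists_eq_add_one_of_ne_zero hr.ne'
    obtain ⟨y, hy, hyα⟩ := intToReal_mem_smul_convexHull r hα
    have hne : ((r + 1 : ℕ) : ℝ) ≠ 0 := Nat.cast_ne_zero.2 hr.ne'
    have hcast : intToReal n ((r + 1) • α) = ((r + 1 : ℕ) : ℝ) • intToReal n α := by
      ext i
      simp [intToReal]
    rw [hcast] at hyα
    rwa [Set.mem_ofPred_eq, ← smul_right_injective _ hne hyα]
  · intro hα
    obtain ⟨ι, _, z, w, hz, hind, hpos, hw, hx⟩ := eq_pos_convex_span_of_mem_convexHull hα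
    choose p hpE hpz using fun i => hz (Set.mem_range_self i)
    obtain rfl : (fun i => intToReal n (p i)) = z := funext hpz
    obtain ⟨q, hq⟩ := exists_rat_weights hind hw hx
    obtain ⟨r, hr, k, hk⟩ := exists_common_denominator (q := q) fun i => by
      exact_mod_cast (hq i).symm ▸ (hpos i).le
    have hkw (i : ι) : (k i : ℝ) = r * w i := by
      rw [← hq]
      exact_mod_cast hk i
    have hsum : ∑ i, k i = r := by
      have h : ∑ i, (k i : ℝ) = r := by simp only [hkw, ← Finset.mul_sum, hw, mul_one]
      exact_mod_cast h
    have hcomb : ∑ i, k i • p i = r • α := by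
      ext j
      have h : ∑ i, (k i : ℝ) * (p i j : ℝ) = r * (α j : ℝ) := by
        have hj := congrFun hx j
        simp only [Finset.sum_apply, Pi.smul_apply, smul_eq_mul, intToReal] at hj
        simp only [hkw, mul_assoc, ← Finset.mul_sum, hj]
      simp only [Finset.sum_apply, Pi.smul_apply, nsmul_eq_mul]
      exact_mod_cast h
    refine ⟨r, hr, ?_⟩
    rw [← hcomb, ← hsum]
    exact sum_nsmul_mem_rFold _ k hpE
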